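/- Let A ∈ ℝ^{n×p} with A ≠ 0, b ∈ ℝⁿ, c ∈ ℝᵖ, let μ_max be the largest eigenvalue of AAᵀ and μ_min the smallest positive eigenvalue of AAᵀ, and let 0 < η < 1/(2√μ_max). Assume the set of Nash equilibria {(x, y) : Aᵀx + c = 0, Ay + b = 0} is nonempty. Let (x_t, y_t) be the OGDA sequence for the game xᵀAy + bᵀx + cᵀy + d with step η and initialization (x₀, y₀, x₋₁, y₋₁), and let D be the distance from (x₀, y₀, x₋₁, y₋₁) to {(x, y, x, y) : Aᵀx + c = 0, Ay + b = 0}. Then (x_t, y_t) converges to (x_∞, y_∞), where x_∞ is the orthogonal projection of x₀ onto the affine set {x : Aᵀx + c = 0} and y_∞ is the orthogonal projection of y₀ onto {y : Ay + b = 0}; moreover for all t ≥ 0, ‖(x_t, y_t) − (x_∞, y_∞)‖ ≤ C · D · λ_max^t, where λ_max = √(½(1 + √(1 − 4η²μ_min))) and C = √( 2 / (1 − √((1 + 5η²μ_max)/(2 + η²μ_max))) ). -/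

import Mathlib

open Matrix Filter

noncomputable section

/-- Squared Euclidean norm of a vector in `ℝ^n`. -/
def sqnorm {n : ℕ} (v : Fin n → ℝ) : ℝ := ∑ i, (v i) ^ 2

/-- A solution of `z_{t+2} = (1 - 2ie) z_{t+1} + ie z_t` with `4e² < 1` is bounded by the
`t`-th power of the modulus of the dominant characteristic root. -/
theorem ogda_scalar_bound (z : ℕ → ℂ) (e : ℝ) (he : e ^ 2 < 1 / 4)
    (hz : ∀ t, z (t + 2) = (1 - 2 * Complex.I * e) * z (t + 1) + Complex.I * e * z t) (t : ℕ) :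
    Complex.normSq (z (t + 1)) ≤
      2 / (1 - Real.sqrt ((1 + 5 * e ^ 2) / (2 + e ^ 2))) *
        (Complex.normSq (z 1) + Complex.normSq (z 0)) *
        ((1 + Real.sqrt (1 - 4 * e ^ 2)) / 2) ^ t := by
  set s := Real.sqrt (1 - 4 * e ^ 2) with hs
  set ρ := Real.sqrt ((1 + 5 * e ^ 2) / (2 + e ^ 2)) with hρ
  have hs2 : s ^ 2 = 1 - 4 * e ^ 2 := Real.sq_sqrt (by linarith)
  have hs0 : 0 < s := Real.sqrt_pos.2 (by linarith)
  have hs1 : s ≤ 1 := by nlinarith [sq_nonneg e]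
  have he0 : 0 ≤ e ^ 2 := sq_nonneg e
  have hρ2 : ρ ^ 2 * (2 + e ^ 2) = 1 + 5 * e ^ 2 := by
    rw [hρ, Real.sq_sqrt (by positivity)]
    field_simp
  have hρ0 : 0 ≤ ρ := Real.sqrt_nonneg _
  have hρ1 : ρ < 1 := by
    by_contra! h
    nlinarith [mul_self_nonneg (ρ - 1)]
  have hsC : (s : ℂ) ≠ 0 := by exact_mod_cast hs0.ne'
  have hs2C : (s : ℂ) ^ 2 = 1 - 4 * e ^ 2 := by exact_mod_cast hs2
  set L : ℂ := (1 + s) / 2 - Complex.I * e with hL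
  set M : ℂ := (1 - s) / 2 - Complex.I * e with hM
  have hLroot : L ^ 2 = (1 - 2 * Complex.I * e) * L + Complex.I * e := by
    linear_combination (1 / 4 : ℂ) * hs2C - (e : ℂ) ^ 2 * Complex.I_sq
  have hMroot : M ^ 2 = (1 - 2 * Complex.I * e) * M + Complex.I * e := by
    linear_combination (1 / 4 : ℂ) * hs2C - (e : ℂ) ^ 2 * Complex.I_sq
  have hLM : L - M = s := by rw [hL, hM]; ring
  obtain ⟨a, ha⟩ : ∃ a : ℂ, a = (z 1 - M * z 0) / s := ⟨_, rfl⟩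
  obtain ⟨b, hb⟩ : ∃ b : ℂ, b = (L * z 0 - z 1) / s := ⟨_, rfl⟩
  have h0 : z 0 = a + b := by
    rw [ha, hb]; field_simp; rw [← hLM]; ring
  have h1 : z 1 = a * L + b * M := by
    rw [ha, hb]; field_simp; rw [← hLM]; ring
  have hsol : ∀ t, z t = a * L ^ t + b * M ^ t ∧
      z (t + 1) = a * L ^ (t + 1) + b * M ^ (t + 1) := by
    intro t
    induction t with
    | zero => exact ⟨by simpa using h0, by simpa using h1⟩
    | succ k ih =>
      refine ⟨ih.2, ?_⟩
      rw [hz, ih.1, ih.2]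
      linear_combination (-a * L ^ k) * hLroot + (-b * M ^ k) * hMroot
  have hLn : Complex.normSq L = (1 + s) / 2 := by
    rw [hL, Complex.normSq_apply]; simp; nlinarith
  have hMn : Complex.normSq M = (1 - s) / 2 := by
    rw [hM, Complex.normSq_apply]; simp; nlinarith
  have hadd : ∀ u v : ℂ, Complex.normSq (u + v) ≤
      2 * Complex.normSq u + 2 * Complex.normSq v := by
    intro u v
    simp only [Complex.normSq_apply, Complex.add_re, Complex.add_im]
    nlinarith [sq_nonneg (u.re - v.re), sq_nonneg (u.im - v.im)]
  have hup : Complex.normSq (z (t + 1)) ≤ 2 * (((1 + s) / 2) ^ t *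
      (Complex.normSq a * (1 + (1 + s) / 2) + Complex.normSq b * (1 + (1 - s) / 2))) := by
    rw [(hsol t).2]
    refine (hadd _ _).trans ?_
    simp only [map_mul, map_pow, hLn, hMn, pow_succ]
    have hp : ((1 - s) / 2) ^ t ≤ ((1 + s) / 2) ^ t :=
      pow_le_pow_left₀ (by linarith) (by linarith) t
    have hq : 0 ≤ ((1 + s) / 2) ^ t := by positivity
    have ha0 := Complex.normSq_nonneg a
    have hb0 := Complex.normSq_nonneg b
    have hbp := mul_le_mul_of_nonneg_left hp
      (mul_nonneg hb0 (by linarith : (0 : ℝ) ≤ (1 - s) / 2))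
    nlinarith [mul_nonneg ha0 hq, mul_nonneg hb0 hq]
  have hlow : (1 - ρ) *
      (Complex.normSq a * (1 + (1 + s) / 2) + Complex.normSq b * (1 + (1 - s) / 2)) ≤
      Complex.normSq (z 1) + Complex.normSq (z 0) := by
    set X := Complex.normSq a * (1 + (1 + s) / 2) with hX
    set Y := Complex.normSq b * (1 + (1 - s) / 2) with hY
    have hX0 : 0 ≤ X := mul_nonneg (Complex.normSq_nonneg a) (by linarith)
    have hY0 : 0 ≤ Y := mul_nonneg (Complex.normSq_nonneg b) (by linarith)
    set w : ℂ := a * (starRingEnd ℂ) b * (L * (starRingEnd ℂ) M + 1) with hw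
    have hexp : Complex.normSq (z 1) + Complex.normSq (z 0) = X + Y + 2 * w.re := by
      have hw' : w.re = (a * L * (starRingEnd ℂ) (b * M)).re + (a * (starRingEnd ℂ) b).re := by
        rw [← Complex.add_re, hw, map_mul]; congr 1; ring
      rw [h0, h1, Complex.normSq_add, Complex.normSq_add, map_mul, map_mul, hLn, hMn, hw', hX, hY]
      ring
    have hLMn : Complex.normSq (L * (starRingEnd ℂ) M + 1) = 1 + 5 * e ^ 2 := by
      have hMc : (starRingEnd ℂ) M = (1 - s) / 2 + Complex.I * e := by
        simp only [hM, map_sub, map_div₀, map_mul, map_one, map_ofNat, Complex.conj_ofReal,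
          Complex.conj_I]
        ring
      have hval : L * (starRingEnd ℂ) M + 1 =
          ((1 + 2 * e ^ 2 : ℝ) : ℂ) + (e * s : ℝ) * Complex.I := by
        rw [hMc, hL]
        push_cast
        linear_combination (-1 / 4 : ℂ) * hs2C - (e : ℂ) ^ 2 * Complex.I_sq
      rw [hval, Complex.normSq_add_mul_I]
      linear_combination e ^ 2 * hs2
    have hwn : Complex.normSq w = ρ ^ 2 * (X * Y) := by
      rw [hw, map_mul, map_mul, Complex.normSq_conj, hLMn, ← hρ2, hX, hY]
      linear_combination (ρ ^ 2 * Complex.normSq a * Complex.normSq b / 4) * hs2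
    have hre : w.re ^ 2 ≤ ρ ^ 2 * (X * Y) := by
      rw [← hwn, Complex.normSq_apply]; nlinarith [sq_nonneg w.im]
    have habs : |2 * w.re| ≤ ρ * (X + Y) := by
      apply abs_le_of_sq_le_sq _ (by positivity)
      nlinarith [mul_nonneg (sq_nonneg ρ) (sq_nonneg (X - Y))]
    rw [hexp]
    linarith [neg_le_of_abs_le habs]
  refine hup.trans ?_
  have hq : 0 ≤ ((1 + s) / 2) ^ t := by positivity
  have h1ρ : 0 < 1 - ρ := by linarith
  calc _ = 2 / (1 - ρ) * ((1 - ρ) * (Complex.normSq a * (1 + (1 + s) / 2) +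
        Complex.normSq b * (1 + (1 - s) / 2))) * ((1 + s) / 2) ^ t := by
        field_simp
    _ ≤ _ := by gcongr

/-- Real form of `ogda_scalar_bound`. -/
theorem ogda_planar_bound (a b : ℕ → ℝ) (e : ℝ) (he : e ^ 2 < 1 / 4)
    (ha : ∀ t, a (t + 2) = a (t + 1) + 2 * e * b (t + 1) - e * b t)
    (hb : ∀ t, b (t + 2) = b (t + 1) - 2 * e * a (t + 1) + e * a t) (t : ℕ) :
    a (t + 1) ^ 2 + b (t + 1) ^ 2 ≤
      2 / (1 - Real.sqrt ((1 + 5 * e ^ 2) / (2 + e ^ 2))) *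
        (a 1 ^ 2 + b 1 ^ 2 + (a 0 ^ 2 + b 0 ^ 2)) *
        ((1 + Real.sqrt (1 - 4 * e ^ 2)) / 2) ^ t := by
  have h := ogda_scalar_bound (fun t => ⟨a t, b t⟩) e he (fun t => by
    apply Complex.ext
    · simp [ha]; ring
    · simp [hb]; ring) t
  simpa only [Complex.normSq_mk, ← sq] using h

theorem sqnorm_nonneg {n : ℕ} (v : Fin n → ℝ) : 0 ≤ sqnorm v :=
  Finset.sum_nonneg fun _ _ => sq_nonneg _

theorem sq_apply_le_sqnorm {n : ℕ} (v : Fin n → ℝ) (i : Fin n) : v i ^ 2 ≤ sqnorm v :=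
  Finset.single_le_sum (f := fun i => v i ^ 2) (fun _ _ => sq_nonneg _) (Finset.mem_univ i)

/-- Orthogonal decomposition of a vector along the kernel of a matrix. -/
theorem exists_ker_orthogonal {m k : ℕ} (B : Matrix (Fin m) (Fin k) ℝ) (w : Fin k → ℝ) :
    ∃ r : Fin k → ℝ, B *ᵥ r = 0 ∧ ∀ z, B *ᵥ z = 0 → (w - r) ⬝ᵥ z = 0 := by
  obtain ⟨r, hr, r', hr', h⟩ :=
    (LinearMap.ker (Matrix.toEuclideanLin B)).exists_add_mem_mem_orthogonal (WithLp.toLp 2 w)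
  refine ⟨r.ofLp, ?_, fun z hz => ?_⟩
  · simpa [Matrix.toLpLin_apply] using hr
  · have hzk : WithLp.toLp 2 z ∈ LinearMap.ker (Matrix.toEuclideanLin B) := by
      simpa [Matrix.toLpLin_apply] using hz
    have h1 := (Submodule.mem_orthogonal _ _).1 hr' _ hzk
    have h2 : w - r.ofLp = r'.ofLp := by
      have := congrArg WithLp.ofLp h
      simp only [WithLp.ofLp_add] at this
      rw [this]; simp
    rw [h2]
    simpa [EuclideanSpace.inner_eq_star_dotProduct] using h1

/-- Singular vector pairs of `A`, with signed singular values, resolving the Euclidean norm. -/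
theorem exists_singular_pairs {n p : ℕ} (A : Matrix (Fin n) (Fin p) ℝ) :
    ∃ (P : Fin n ⊕ Fin p → Fin n → ℝ) (Q : Fin n ⊕ Fin p → Fin p → ℝ) (σ : Fin n ⊕ Fin p → ℝ),
      (∀ j, A *ᵥ Q j = σ j • P j) ∧ (∀ j, Aᵀ *ᵥ P j = σ j • Q j) ∧
      (∀ j, P j = 0 → Q j ≠ 0) ∧
      ∀ u v, ∑ j, ((P j ⬝ᵥ u) ^ 2 + (Q j ⬝ᵥ v) ^ 2) = sqnorm u + sqnorm v := by
  have hH : (fromBlocks 0 A Aᵀ 0).IsHermitian := by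
    simp [Matrix.IsHermitian, fromBlocks_transpose, conjTranspose_eq_transpose_of_trivial]
  let w := hH.eigenvectorBasis
  have hw : ∀ j, fromBlocks 0 A Aᵀ 0 *ᵥ (w j).ofLp = hH.eigenvalues j • (w j).ofLp :=
    hH.mulVec_eigenvectorBasis
  refine ⟨fun j => (w j).ofLp ∘ Sum.inl, fun j => (w j).ofLp ∘ Sum.inr, hH.eigenvalues,
    fun j => ?_, fun j => ?_, fun j hP hQ => ?_, fun u v => ?_⟩
  · have := hw j
    rw [fromBlocks_mulVec] at this
    funext i
    simpa using congrFun this (Sum.inl i)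
  · have := hw j
    rw [fromBlocks_mulVec] at this
    funext i
    simpa using congrFun this (Sum.inr i)
  · apply w.toBasis.ne_zero j
    ext i
    rcases i with i | i
    · simpa using congrFun hP i
    · simpa using congrFun hQ i
  · have key : ∀ v : Fin p → ℝ,
        ∑ j, (((w j).ofLp ∘ Sum.inl) ⬝ᵥ u + ((w j).ofLp ∘ Sum.inr) ⬝ᵥ v) ^ 2 =
          sqnorm u + sqnorm v := by
      intro v
      have h := w.sum_sq_inner_right (WithLp.toLp 2 (Sum.elim u v))
      rw [EuclideanSpace.real_norm_sq_eq] at h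
      simp only [Fintype.sum_sum_type, Sum.elim_inl, Sum.elim_inr] at h
      simp only [sqnorm]
      simp only [Fintype.sum_sum_type]
      rw [← h]
      simp [PiLp.inner_apply, dotProduct, mul_comm]
    have h1 := key v
    have h2 := key (-v)
    have h3 : sqnorm (-v) = sqnorm v := by simp [sqnorm]
    rw [h3] at h2
    have h4 := congrArg₂ (· + ·) h1 h2
    simp only [← Finset.sum_add_distrib, dotProduct_neg] at h4
    have h5 : ∑ j, (((w j).ofLp ∘ Sum.inl ⬝ᵥ u) ^ 2 + ((w j).ofLp ∘ Sum.inr ⬝ᵥ v) ^ 2) * 2 =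
        sqnorm u + sqnorm v + (sqnorm u + sqnorm v) := by
      rw [← h4]
      exact Finset.sum_congr rfl fun j _ => by ring
    rw [← Finset.sum_mul] at h5
    linarith

/-- The square of a nonzero singular value lies in the spectrum of `AAᵀ`. -/
theorem sq_singular_mem_spectrum {n p : ℕ} (A : Matrix (Fin n) (Fin p) ℝ)
    {P : Fin n → ℝ} {Q : Fin p → ℝ} {σ : ℝ} (hQ : A *ᵥ Q = σ • P) (hP : Aᵀ *ᵥ P = σ • Q)
    (h0 : P = 0 → Q ≠ 0) (hσ : σ ≠ 0) : σ ^ 2 ∈ spectrum ℝ (A * Aᵀ) := by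
  have hP0 : P ≠ 0 := fun h => h0 h (by simpa [h, hσ] using hP.symm)
  rw [← Matrix.spectrum_toLin']
  apply Module.End.HasEigenvalue.mem_spectrum
  apply Module.End.hasEigenvalue_of_hasEigenvector (x := P)
  rw [Module.End.hasEigenvector_iff, Module.End.mem_eigenspace_iff]
  refine ⟨?_, hP0⟩
  rw [Matrix.toLin'_apply, ← Matrix.mulVec_mulVec, hP, Matrix.mulVec_smul, hQ, smul_smul, sq]


/-- The constants of the planar bound are monotone in the squared step `e²`. -/
theorem ogda_constants_mono {m e M t : ℝ} (hm : 0 ≤ m) (hme : m ≤ e) (heM : e ≤ M)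
    (hM : M < 1 / 4) (k : ℕ) (ht : 0 ≤ t) :
    2 / (1 - Real.sqrt ((1 + 5 * e) / (2 + e))) * t *
        ((1 + Real.sqrt (1 - 4 * e)) / 2) ^ k ≤
      2 / (1 - Real.sqrt ((1 + 5 * M) / (2 + M))) * t *
        ((1 + Real.sqrt (1 - 4 * m)) / 2) ^ k := by
  have he : 0 ≤ e := hm.trans hme
  have h1 : Real.sqrt ((1 + 5 * e) / (2 + e)) ≤ Real.sqrt ((1 + 5 * M) / (2 + M)) := by
    apply Real.sqrt_le_sqrt
    rw [div_le_div_iff₀ (by linarith) (by linarith)]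
    nlinarith
  have h2 : Real.sqrt ((1 + 5 * M) / (2 + M)) < 1 := by
    rw [Real.sqrt_lt' one_pos, one_pow, div_lt_one (by linarith)]
    linarith
  have h3 : 0 < 1 - Real.sqrt ((1 + 5 * M) / (2 + M)) := by linarith
  gcongr

theorem dotProduct_mulVec_eq_transpose {n p : ℕ} (A : Matrix (Fin n) (Fin p) ℝ)
    (u : Fin n → ℝ) (v : Fin p → ℝ) : u ⬝ᵥ (A *ᵥ v) = (Aᵀ *ᵥ u) ⬝ᵥ v := by
  rw [dotProduct_mulVec, mulVec_transpose]

/-- Energy estimate for OGDA on the homogeneous game `xᵀAy`, started orthogonally to the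
equilibria. -/
theorem ogda_energy_bound {n p : ℕ} (A : Matrix (Fin n) (Fin p) ℝ) {μmax μmin η : ℝ}
    (hμmax : IsGreatest (spectrum ℝ (A * Aᵀ)) μmax)
    (hμmin : IsLeast {μ ∈ spectrum ℝ (A * Aᵀ) | 0 < μ} μmin)
    (hη : η ^ 2 * μmax < 1 / 4)
    (U : ℕ → Fin n → ℝ) (V : ℕ → Fin p → ℝ)
    (hU : ∀ t, U (t + 2) = U (t + 1) + (2 * η) • (A *ᵥ V (t + 1)) - η • (A *ᵥ V t))
    (hV : ∀ t, V (t + 2) = V (t + 1) - (2 * η) • (Aᵀ *ᵥ U (t + 1)) + η • (Aᵀ *ᵥ U t))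
    (hU1 : ∀ k, Aᵀ *ᵥ k = 0 → U 1 ⬝ᵥ k = 0) (hV1 : ∀ l, A *ᵥ l = 0 → V 1 ⬝ᵥ l = 0)
    {k : Fin n → ℝ} {l : Fin p → ℝ} (hk : Aᵀ *ᵥ k = 0) (hl : A *ᵥ l = 0) (t : ℕ) :
    sqnorm (U (t + 1)) + sqnorm (V (t + 1)) ≤
      2 / (1 - Real.sqrt ((1 + 5 * (η ^ 2 * μmax)) / (2 + η ^ 2 * μmax))) *
        (sqnorm (U 1 + k) + sqnorm (V 1 + l) + (sqnorm (U 0 + k) + sqnorm (V 0 + l))) *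
        ((1 + Real.sqrt (1 - 4 * (η ^ 2 * μmin))) / 2) ^ t := by
  obtain ⟨P, Q, σ, hQ, hP, hPQ, hsum⟩ := exists_singular_pairs A
  have hrecU : ∀ j t, P j ⬝ᵥ U (t + 2) = P j ⬝ᵥ U (t + 1) +
      2 * (η * σ j) * (Q j ⬝ᵥ V (t + 1)) - η * σ j * (Q j ⬝ᵥ V t) := by
    intro j t
    rw [hU, dotProduct_sub, dotProduct_add, dotProduct_smul, dotProduct_smul,
      dotProduct_mulVec_eq_transpose, dotProduct_mulVec_eq_transpose, hP,
      smul_dotProduct, smul_dotProduct]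
    simp only [smul_eq_mul]
    ring
  have hrecV : ∀ j t, Q j ⬝ᵥ V (t + 2) = Q j ⬝ᵥ V (t + 1) -
      2 * (η * σ j) * (P j ⬝ᵥ U (t + 1)) + η * σ j * (P j ⬝ᵥ U t) := by
    intro j t
    rw [hV, dotProduct_add, dotProduct_sub, dotProduct_smul, dotProduct_smul,
      dotProduct_mulVec_eq_transpose, dotProduct_mulVec_eq_transpose, transpose_transpose, hQ,
      smul_dotProduct, smul_dotProduct]
    simp only [smul_eq_mul]
    ring
  rw [← hsum, ← hsum, ← hsum, ← Finset.sum_add_distrib, Finset.mul_sum, Finset.sum_mul]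
  refine Finset.sum_le_sum fun j _ => ?_
  have hmm : μmin ≤ μmax := hμmax.2 hμmin.1.1
  have hm0 : 0 < μmin := hμmin.1.2
  have hη0 : 0 ≤ η ^ 2 := sq_nonneg η
  by_cases hσ : σ j = 0
  · have hzU : ∀ t, P j ⬝ᵥ U (t + 1) = 0 := by
      intro t
      induction t with
      | zero => rw [dotProduct_comm]; exact hU1 _ (by rw [hP, hσ, zero_smul])
      | succ t ih => simpa [hσ, ih] using hrecU j t
    have hzV : ∀ t, Q j ⬝ᵥ V (t + 1) = 0 := by
      intro t
      induction t with
      | zero => rw [dotProduct_comm]; exact hV1 _ (by rw [hQ, hσ, zero_smul])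
      | succ t ih => simpa [hσ, ih] using hrecV j t
    rw [hzU, hzV]
    have := ogda_constants_mono (t := (P j ⬝ᵥ (U 1 + k)) ^ 2 + (Q j ⬝ᵥ (V 1 + l)) ^ 2 +
        ((P j ⬝ᵥ (U 0 + k)) ^ 2 + (Q j ⬝ᵥ (V 0 + l)) ^ 2)) (by positivity)
      (mul_le_mul_of_nonneg_left hmm hη0) le_rfl hη t (by positivity)
    refine le_trans ?_ this
    have h2 : Real.sqrt ((1 + 5 * (η ^ 2 * μmax)) / (2 + η ^ 2 * μmax)) ≤ 1 := by
      have : 0 ≤ η ^ 2 * μmax := mul_nonneg hη0 (hm0.le.trans hmm)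
      rw [Real.sqrt_le_one, div_le_one (by linarith)]
      linarith
    have h3 : 0 ≤ 1 - Real.sqrt ((1 + 5 * (η ^ 2 * μmax)) / (2 + η ^ 2 * μmax)) := by linarith
    rw [zero_pow two_ne_zero, add_zero]
    positivity
  · have hmem := sq_singular_mem_spectrum A (hQ j) (hP j) (hPQ j) hσ
    have hle : σ j ^ 2 ≤ μmax := hμmax.2 hmem
    have hge : μmin ≤ σ j ^ 2 := hμmin.2 ⟨hmem, by positivity⟩
    have hPk : P j ⬝ᵥ k = 0 := by
      have h := dotProduct_mulVec_eq_transpose Aᵀ (Q j) k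
      rw [hk, dotProduct_zero, transpose_transpose, hQ, smul_dotProduct, smul_eq_mul] at h
      exact (mul_eq_zero.1 h.symm).resolve_left hσ
    have hQl : Q j ⬝ᵥ l = 0 := by
      have h := dotProduct_mulVec_eq_transpose A (P j) l
      rw [hl, dotProduct_zero, hP, smul_dotProduct, smul_eq_mul] at h
      exact (mul_eq_zero.1 h.symm).resolve_left hσ
    simp only [dotProduct_add, hPk, hQl, add_zero]
    have hle' : η ^ 2 * σ j ^ 2 ≤ η ^ 2 * μmax := mul_le_mul_of_nonneg_left hle hη0
    have h := ogda_planar_bound (fun t => P j ⬝ᵥ U t) (fun t => Q j ⬝ᵥ V t) (η * σ j)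
      (by rw [mul_pow]; linarith) (hrecU j) (hrecV j) t
    refine h.trans ?_
    rw [mul_pow]
    exact ogda_constants_mono (by positivity) (mul_le_mul_of_nonneg_left hge hη0) hle' hη t
      (by positivity)

/-- **Theorem (exponential convergence of OGDA for affine zero-sum games).**
For the game `xᵀAy + bᵀx + cᵀy + d` with `A ≠ 0`, nonempty set of Nash equilibria, and
`0 < η < 1/(2√μ_max)`, the OGDA iterates converge to `(x_∞, y_∞)`, the orthogonal
projections of `x₀` onto `{x : Aᵀx + c = 0}` and of `y₀` onto `{y : Ay + b = 0}`;
moreover `‖(x_t,y_t) − (x_∞,y_∞)‖ ≤ C·D·λ_max^t` for all `t`, with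
`λ_max = √(½(1+√(1−4η²μ_min)))` and `C = √(2/(1−√((1+5η²μ_max)/(2+η²μ_max))))`. -/
theorem ogda_affine_zero_sum_exponential_rate
    {n p : ℕ} (A : Matrix (Fin n) (Fin p) ℝ) (hA : A ≠ 0)
    (b : Fin n → ℝ) (c : Fin p → ℝ) (d : ℝ)
    (μmax μmin : ℝ)
    (hμmax : IsGreatest (spectrum ℝ (A * Aᵀ)) μmax)
    (hμmin : IsLeast {μ ∈ spectrum ℝ (A * Aᵀ) | 0 < μ} μmin)
    (η : ℝ) (hη0 : 0 < η) (hη1 : η < 1 / (2 * Real.sqrt μmax))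
    (hNE : ∃ (xs : Fin n → ℝ) (ys : Fin p → ℝ), Aᵀ *ᵥ xs + c = 0 ∧ A *ᵥ ys + b = 0)
    (x : ℕ → Fin n → ℝ) (y : ℕ → Fin p → ℝ)
    (xm1 : Fin n → ℝ) (ym1 : Fin p → ℝ)
    (hx1 : x 1 = x 0 + (2 * η) • (A *ᵥ y 0 + b) - η • (A *ᵥ ym1 + b))
    (hy1 : y 1 = y 0 - (2 * η) • (Aᵀ *ᵥ x 0 + c) + η • (Aᵀ *ᵥ xm1 + c))
    (hx : ∀ t, x (t + 2) = x (t + 1) + (2 * η) • (A *ᵥ y (t + 1) + b) - η • (A *ᵥ y t + b))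
    (hy : ∀ t, y (t + 2) = y (t + 1) - (2 * η) • (Aᵀ *ᵥ x (t + 1) + c) + η • (Aᵀ *ᵥ x t + c))
    (D : ℝ)
    (hD : D = sInf {dd : ℝ | ∃ (xs : Fin n → ℝ) (ys : Fin p → ℝ),
      Aᵀ *ᵥ xs + c = 0 ∧ A *ᵥ ys + b = 0 ∧
      dd = Real.sqrt (sqnorm (x 0 - xs) + sqnorm (y 0 - ys) +
            sqnorm (xm1 - xs) + sqnorm (ym1 - ys))}) :
    ∃ (xinf : Fin n → ℝ) (yinf : Fin p → ℝ),
      Tendsto (fun t => (x t, y t)) atTop (nhds (xinf, yinf)) ∧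
      Aᵀ *ᵥ xinf + c = 0 ∧ A *ᵥ yinf + b = 0 ∧
      (∀ x' : Fin n → ℝ, Aᵀ *ᵥ x' = 0 → (x 0 - xinf) ⬝ᵥ x' = 0) ∧
      (∀ y' : Fin p → ℝ, A *ᵥ y' = 0 → (y 0 - yinf) ⬝ᵥ y' = 0) ∧
      ∀ t, Real.sqrt (sqnorm (x t - xinf) + sqnorm (y t - yinf)) ≤
        Real.sqrt (2 / (1 - Real.sqrt ((1 + 5 * η^2 * μmax) / (2 + η^2 * μmax)))) * D *
          (Real.sqrt ((1 + Real.sqrt (1 - 4 * η^2 * μmin)) / 2)) ^ t := by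
  have hmm : μmin ≤ μmax := hμmax.2 hμmin.1.1
  have hm0 : 0 < μmin := hμmin.1.2
  have hM0 : 0 < μmax := hm0.trans_le hmm
  have hη : η ^ 2 * μmax < 1 / 4 := by
    have h : η * Real.sqrt μmax < 1 / 2 := by
      have hs := Real.sqrt_pos.2 hM0
      rw [lt_div_iff₀ (by positivity)] at hη1
      linarith
    have h2 : (η * Real.sqrt μmax) ^ 2 < (1 / 2) ^ 2 :=
      pow_lt_pow_left₀ h (by positivity) two_ne_zero
    rw [mul_pow, Real.sq_sqrt hM0.le] at h2
    linarith
  obtain ⟨xs₀, ys₀, hxs₀, hys₀⟩ := hNE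
  obtain ⟨r, hr, hr'⟩ := exists_ker_orthogonal Aᵀ (x 0 - xs₀)
  obtain ⟨q, hq, hq'⟩ := exists_ker_orthogonal A (y 0 - ys₀)
  obtain ⟨xinf, hxinf⟩ : ∃ v, v = xs₀ + r := ⟨_, rfl⟩
  obtain ⟨yinf, hyinf⟩ : ∃ v, v = ys₀ + q := ⟨_, rfl⟩
  have hX : Aᵀ *ᵥ xinf + c = 0 := by rw [hxinf, mulVec_add, hr, add_zero, hxs₀]
  have hY : A *ᵥ yinf + b = 0 := by rw [hyinf, mulVec_add, hq, add_zero, hys₀]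
  rw [sub_sub, ← hxinf] at hr'
  rw [sub_sub, ← hyinf] at hq'
  have hAy : ∀ v, A *ᵥ v + b = A *ᵥ (v - yinf) := fun v => by
    rw [mulVec_sub, eq_neg_of_add_eq_zero_left hY, sub_neg_eq_add]
  have hAx : ∀ v, Aᵀ *ᵥ v + c = Aᵀ *ᵥ (v - xinf) := fun v => by
    rw [mulVec_sub, eq_neg_of_add_eq_zero_left hX, sub_neg_eq_add]
  set C := 2 / (1 - Real.sqrt ((1 + 5 * η^2 * μmax) / (2 + η^2 * μmax))) with hC
  set Λ := (1 + Real.sqrt (1 - 4 * η^2 * μmin)) / 2 with hΛ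
  have hC0 : 0 < C := by
    have h2 : Real.sqrt ((1 + 5 * η ^ 2 * μmax) / (2 + η ^ 2 * μmax)) < 1 := by
      have : 0 < η ^ 2 * μmax := by positivity
      rw [Real.sqrt_lt' one_pos, one_pow, div_lt_one (by linarith)]
      linarith
    exact div_pos two_pos (by linarith)
  have hΛ0 : 0 < Λ := by positivity
  have hΛ1 : Λ < 1 := by
    have h2 : Real.sqrt (1 - 4 * η ^ 2 * μmin) < 1 := by
      have : 0 < η ^ 2 * μmin := by positivity
      rw [Real.sqrt_lt' one_pos]
      linarith
    linarith
  have hbound : ∀ t xs ys, Aᵀ *ᵥ xs + c = 0 → A *ᵥ ys + b = 0 →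
      sqnorm (x t - xinf) + sqnorm (y t - yinf) ≤
        C * (sqnorm (x 0 - xs) + sqnorm (y 0 - ys) +
            sqnorm (xm1 - xs) + sqnorm (ym1 - ys)) * Λ ^ t := by
    intro t xs ys hxs hys
    have h := ogda_energy_bound A hμmax hμmin hη
      (fun t => Nat.casesOn t (xm1 - xinf) fun t => x t - xinf)
      (fun t => Nat.casesOn t (ym1 - yinf) fun t => y t - yinf)
      (fun t => by
        cases t with
        | zero =>
          change x 1 - xinf = x 0 - xinf + (2 * η) • (A *ᵥ (y 0 - yinf)) -
            η • (A *ᵥ (ym1 - yinf))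
          rw [hx1, hAy, hAy]; abel
        | succ t => simp only [hx, hAy]; abel)
      (fun t => by
        cases t with
        | zero =>
          change y 1 - yinf = y 0 - yinf - (2 * η) • (Aᵀ *ᵥ (x 0 - xinf)) +
            η • (Aᵀ *ᵥ (xm1 - xinf))
          rw [hy1, hAx, hAx]; abel
        | succ t => simp only [hy, hAx]; abel)
      hr' hq' (k := xinf - xs) (l := yinf - ys)
      (by rw [mulVec_sub, eq_neg_of_add_eq_zero_left hX, eq_neg_of_add_eq_zero_left hxs, sub_self])
      (by rw [mulVec_sub, eq_neg_of_add_eq_zero_left hY, eq_neg_of_add_eq_zero_left hys, sub_self])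
      t
    change _ ≤ _ * (sqnorm (x 0 - xinf + (xinf - xs)) + sqnorm (y 0 - yinf + (yinf - ys)) +
      (sqnorm (xm1 - xinf + (xinf - xs)) + sqnorm (ym1 - yinf + (yinf - ys)))) * _ at h
    simp only [sub_add_sub_cancel] at h
    rw [hC, hΛ]
    simpa only [← add_assoc, ← mul_assoc] using h
  have hrate : ∀ t, Real.sqrt (sqnorm (x t - xinf) + sqnorm (y t - yinf)) ≤
      Real.sqrt C * D * Real.sqrt Λ ^ t := by
    intro t
    have hK : 0 < Real.sqrt C * Real.sqrt Λ ^ t := by positivity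
    rw [mul_right_comm, ← div_le_iff₀' hK, hD]
    refine le_csInf ⟨_, xs₀, ys₀, hxs₀, hys₀, rfl⟩ ?_
    rintro _ ⟨xs, ys, hxs, hys, rfl⟩
    rw [div_le_iff₀' hK]
    refine (Real.sqrt_le_sqrt (hbound t xs ys hxs hys)).trans_eq ?_
    have hpow : Real.sqrt (Λ ^ t) = Real.sqrt Λ ^ t := by
      rw [Real.sqrt_eq_iff_mul_self_eq (by positivity) (by positivity), ← mul_pow,
        Real.mul_self_sqrt hΛ0.le]
    rw [mul_right_comm, Real.sqrt_mul (by positivity), Real.sqrt_mul hC0.le, hpow]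
  have hlim : Tendsto (fun t => Real.sqrt C * D * Real.sqrt Λ ^ t) atTop (nhds 0) := by
    have h1 : Real.sqrt Λ < 1 := by rwa [Real.sqrt_lt' one_pos, one_pow]
    simpa using (tendsto_pow_atTop_nhds_zero_of_lt_one (Real.sqrt_nonneg Λ) h1).const_mul
      (Real.sqrt C * D)
  refine ⟨xinf, yinf, ?_, hX, hY, hr', hq', hrate⟩
  refine Tendsto.prodMk_nhds (tendsto_pi_nhds.2 fun i => ?_) (tendsto_pi_nhds.2 fun i => ?_)
  · rw [tendsto_iff_dist_tendsto_zero]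
    refine squeeze_zero (fun _ => dist_nonneg) (fun t => (Real.abs_le_sqrt ?_).trans (hrate t)) hlim
    exact (sq_apply_le_sqnorm (x t - xinf) i).trans (le_add_of_nonneg_right (sqnorm_nonneg _))
  · rw [tendsto_iff_dist_tendsto_zero]
    refine squeeze_zero (fun _ => dist_nonneg) (fun t => (Real.abs_le_sqrt ?_).trans (hrate t)) hlim
    exact (sq_apply_le_sqnorm (y t - yinf) i).trans (le_add_of_nonneg_left (sqnorm_nonneg _))


end
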